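/- arXiv:1006.2914 — 5 statements merged into one kernel-verified Lean document; each statement's English description precedes it below -/
import Mathlib

section
/- Let p ∈ ℝ satisfy p + p_c(0) ≥ 0, and define g(S) := a(S)·(p + p_c(S)) for S ∈ [0,1]. Then g maps [0,1] bijectively onto the interval [C_h·(p + p_c(0)), C_v·(p + p_c(1))]; consequently, for every ρ in this interval there exists a unique S_g ∈ [0,1] with ρ = a(S_g)·(p + p_c(S_g)), and this S_g is strictly positive if and only if ρ > C_h·(p + p_c(0)). In other words, the gas phase is present exactly when the total hydrogen concentration exceeds the threshold C_h·(p + p_c(0)). -/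
open Set

/-- For `p + p_c(0) ≥ 0`, `g(S) = a(S)·(p + p_c(S))` maps `[0,1]`
bijectively onto `[C_h(p + p_c(0)), C_v(p + p_c(1))]`; every `ρ` in this interval
is attained at a unique `S_g ∈ [0,1]`, and `S_g > 0` iff `ρ > C_h(p + p_c(0))`. -/
theorem stmt_1
    (Ch Cv : ℝ) (hCh : 0 < Ch) (hCC : Ch < Cv)
    (pc : ℝ → ℝ) (hpc_cont : ContinuousOn pc (Icc 0 1))
    (hpc_mono : StrictMonoOn pc (Icc 0 1))
    (p : ℝ) (hp : 0 ≤ p + pc 0) :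
    Set.BijOn (fun S => (Ch * (1 - S) + Cv * S) * (p + pc S)) (Icc 0 1)
      (Icc (Ch * (p + pc 0)) (Cv * (p + pc 1))) ∧
    ∀ ρ ∈ Icc (Ch * (p + pc 0)) (Cv * (p + pc 1)),
      (∃! S, S ∈ Icc (0:ℝ) 1 ∧ ρ = (Ch * (1 - S) + Cv * S) * (p + pc S)) ∧
      ∀ S ∈ Icc (0:ℝ) 1, ρ = (Ch * (1 - S) + Cv * S) * (p + pc S) →
        (0 < S ↔ Ch * (p + pc 0) < ρ) := by
  set g : ℝ → ℝ := fun S => (Ch * (1 - S) + Cv * S) * (p + pc S) with hg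
  have h0 : (0 : ℝ) ∈ Icc (0 : ℝ) 1 := left_mem_Icc.2 zero_le_one
  have h1 : (1 : ℝ) ∈ Icc (0 : ℝ) 1 := right_mem_Icc.2 zero_le_one
  have g0 : g 0 = Ch * (p + pc 0) := by simp [hg]
  have g1 : g 1 = Cv * (p + pc 1) := by simp [hg]
  have hmono : StrictMonoOn g (Icc 0 1) := by
    intro x hx y hy hxy
    have hpx : 0 ≤ p + pc x := by linarith [hpc_mono.monotoneOn h0 hx hx.1]
    have hpxy : p + pc x < p + pc y := by linarith [hpc_mono hx hy hxy]
    have ha : Ch * (1 - x) + Cv * x < Ch * (1 - y) + Cv * y := by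
      nlinarith [mul_pos (sub_pos.2 hCC) (sub_pos.2 hxy)]
    have hay : 0 < Ch * (1 - y) + Cv * y := by
      nlinarith [mul_nonneg (sub_pos.2 hCC).le hy.1]
    exact mul_lt_mul' ha.le hpxy hpx hay
  have hcont : ContinuousOn g (Icc 0 1) := by fun_prop
  have hbij : BijOn g (Icc 0 1) (Icc (Ch * (p + pc 0)) (Cv * (p + pc 1))) := by
    rw [← g0, ← g1]
    exact ⟨fun x hx => ⟨hmono.monotoneOn h0 hx hx.1, hmono.monotoneOn hx h1 hx.2⟩,
      hmono.injOn, intermediate_value_Icc zero_le_one hcont⟩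
  refine ⟨hbij, fun ρ hρ => ⟨?_, ?_⟩⟩
  · obtain ⟨S, hS, hgS⟩ := hbij.surjOn hρ
    exact ⟨S, ⟨hS, hgS.symm⟩, fun T hT => hbij.injOn hT.1 hS (hT.2.symm.trans hgS.symm)⟩
  · rintro S hS rfl
    rw [← g0]
    exact (hmono.lt_iff_lt h0 hS).symm
end

section
/- Fix p ∈ ℝ with p + p_c(0) ≥ 0. Let S₀ ∈ (0,1), suppose p_c has derivative q > 0 at S₀, and set ρ₀ := a(S₀)·(p + p_c(S₀)). If S is a real function of ρ that is continuous at ρ₀, satisfies S(ρ₀) = S₀, and satisfies a(S(ρ))·(p + p_c(S(ρ))) = ρ for all ρ in a neighborhood of ρ₀, then S is differentiable at ρ₀ with derivative ∂S/∂ρ = a(S₀) / (C_Δ·ρ₀ + a(S₀)²·q), and this derivative is strictly positive. -/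
open Set

/-- differentiability of the gas saturation `S_g` with respect to the
total hydrogen concentration `ρ_tot^h` at fixed liquid pressure `p`:
if `ρ₀ = a(S₀)(p + p_c(S₀))`, `p_c` has derivative `q > 0` at `S₀ ∈ (0,1)`, and
`S(ρ)` solves `a(S(ρ))(p + p_c(S(ρ))) = ρ` near `ρ₀` with `S(ρ₀) = S₀`, then
`S'(ρ₀) = a(S₀)/(C_Δ ρ₀ + a(S₀)² q) > 0`. -/
theorem stmt_2
    (Ch Cv : ℝ) (hCh : 0 < Ch) (hCC : Ch < Cv)
    (pc : ℝ → ℝ) (hpc_cont : ContinuousOn pc (Icc 0 1))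
    (hpc_mono : StrictMonoOn pc (Icc 0 1))
    (p : ℝ) (hp : 0 ≤ p + pc 0)
    (S₀ : ℝ) (hS₀ : S₀ ∈ Ioo (0:ℝ) 1)
    (q : ℝ) (hq : 0 < q) (hpcq : HasDerivAt pc q S₀)
    (ρ₀ : ℝ) (hρ₀ : ρ₀ = (Ch * (1 - S₀) + Cv * S₀) * (p + pc S₀))
    (S : ℝ → ℝ) (hScont : ContinuousAt S ρ₀) (hSval : S ρ₀ = S₀)
    (hSimp : ∀ᶠ ρ in nhds ρ₀, (Ch * (1 - S ρ) + Cv * S ρ) * (p + pc (S ρ)) = ρ) :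
    HasDerivAt S
      ((Ch * (1 - S₀) + Cv * S₀) /
        ((Cv - Ch) * ρ₀ + (Ch * (1 - S₀) + Cv * S₀) ^ 2 * q)) ρ₀ ∧
    0 < (Ch * (1 - S₀) + Cv * S₀) /
        ((Cv - Ch) * ρ₀ + (Ch * (1 - S₀) + Cv * S₀) ^ 2 * q) := by
  obtain ⟨hS₀_pos, hS₀_lt⟩ := hS₀
  have hpc_pos : 0 < p + pc S₀ := by
    have := hpc_mono (left_mem_Icc.2 zero_le_one) ⟨hS₀_pos.le, hS₀_lt.le⟩ hS₀_pos
    linarith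
  have ha_deriv : HasDerivAt (fun s : ℝ => Ch * (1 - s) + Cv * s) (Cv - Ch) S₀ := by
    have h := (((hasDerivAt_id' S₀).const_sub 1).const_mul Ch).add
      ((hasDerivAt_id' S₀).const_mul Cv)
    exact h.congr_deriv (by ring)
  have ha : 0 < Ch * (1 - S₀) + Cv * S₀ := by nlinarith
  have hf := ha_deriv.mul (hpcq.const_add p)
  have hC : 0 < Cv - Ch := sub_pos.2 hCC
  have hf_pos : 0 < (Cv - Ch) * (p + pc S₀) + (Ch * (1 - S₀) + Cv * S₀) * q := by
    positivity
  have h_eq : (Ch * (1 - S₀) + Cv * S₀) /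
      ((Cv - Ch) * ρ₀ + (Ch * (1 - S₀) + Cv * S₀) ^ 2 * q) =
      ((Cv - Ch) * (p + pc S₀) + (Ch * (1 - S₀) + Cv * S₀) * q)⁻¹ := by
    have h_denom : (Cv - Ch) * ρ₀ + (Ch * (1 - S₀) + Cv * S₀) ^ 2 * q =
        (Ch * (1 - S₀) + Cv * S₀) *
          ((Cv - Ch) * (p + pc S₀) + (Ch * (1 - S₀) + Cv * S₀) * q) := by
      rw [hρ₀]
      ring
    rw [h_denom, div_mul_cancel_left₀ ha.ne']
  rw [h_eq]
  rw [← hSval] at hf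
  refine ⟨?_, inv_pos.2 hf_pos⟩
  have h := hf.of_local_left_inverse hScont (by rw [hSval]; exact hf_pos.ne') hSimp
  rwa [hSval] at h
end

section
/- Fix ρ₀ ∈ ℝ. Let p₀ ∈ ℝ with p₀ + p_c(0) ≥ 0, let S₀ ∈ (0,1), suppose p_c has derivative q > 0 at S₀, and suppose ρ₀ = a(S₀)·(p₀ + p_c(S₀)). If S is a real function of p that is continuous at p₀, satisfies S(p₀) = S₀, and satisfies a(S(p))·(p + p_c(S(p))) = ρ₀ for all p in a neighborhood of p₀, then S is differentiable at p₀ with derivative ∂S/∂p = −a(S₀)² / (C_Δ·ρ₀ + a(S₀)²·q), and this derivative is strictly negative. -/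
open Set

/-- differentiability of the gas saturation `S_g` with respect to the
liquid pressure `p` at fixed total hydrogen concentration `ρ₀`:
if `ρ₀ = a(S₀)(p₀ + p_c(S₀))`, `p_c` has derivative `q > 0` at `S₀ ∈ (0,1)`, and
`S(p)` solves `a(S(p))(p + p_c(S(p))) = ρ₀` near `p₀` with `S(p₀) = S₀`, then
`S'(p₀) = -a(S₀)²/(C_Δ ρ₀ + a(S₀)² q) < 0`. -/
theorem stmt_3
    (Ch Cv : ℝ) (hCh : 0 < Ch) (hCC : Ch < Cv)
    (pc : ℝ → ℝ) (hpc_cont : ContinuousOn pc (Icc 0 1))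
    (hpc_mono : StrictMonoOn pc (Icc 0 1))
    (ρ₀ : ℝ)
    (p₀ : ℝ) (hp₀ : 0 ≤ p₀ + pc 0)
    (S₀ : ℝ) (hS₀ : S₀ ∈ Ioo (0:ℝ) 1)
    (q : ℝ) (hq : 0 < q) (hpcq : HasDerivAt pc q S₀)
    (hρ₀ : ρ₀ = (Ch * (1 - S₀) + Cv * S₀) * (p₀ + pc S₀))
    (S : ℝ → ℝ) (hScont : ContinuousAt S p₀) (hSval : S p₀ = S₀)
    (hSimp : ∀ᶠ p in nhds p₀, (Ch * (1 - S p) + Cv * S p) * (p + pc (S p)) = ρ₀) :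
    HasDerivAt S
      (-(Ch * (1 - S₀) + Cv * S₀) ^ 2 /
        ((Cv - Ch) * ρ₀ + (Ch * (1 - S₀) + Cv * S₀) ^ 2 * q)) p₀ ∧
    (-(Ch * (1 - S₀) + Cv * S₀) ^ 2 /
        ((Cv - Ch) * ρ₀ + (Ch * (1 - S₀) + Cv * S₀) ^ 2 * q)) < 0 := by
  set a : ℝ → ℝ := fun s => Ch * (1 - s) + Cv * s with ha
  have ha_pos : 0 < a S₀ := by
    have h₁ : 0 < Ch * (1 - S₀) := mul_pos hCh (by linarith [hS₀.2])
    have h₂ : 0 < Cv * S₀ := mul_pos (hCh.trans hCC) hS₀.1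
    exact add_pos h₁ h₂
  have hpc_lt : pc 0 < pc S₀ :=
    hpc_mono (by simp) (Ioo_subset_Icc_self hS₀) hS₀.1
  have hρ_pos : 0 < ρ₀ := by
    rw [hρ₀]
    exact mul_pos ha_pos (by linarith)
  have hden : 0 < (Cv - Ch) * ρ₀ + a S₀ ^ 2 * q :=
    add_pos (mul_pos (sub_pos.2 hCC) hρ_pos) (by positivity)
  have ha_deriv : HasDerivAt a (Cv - Ch) S₀ := by
    have h := (((hasDerivAt_id S₀).const_sub 1).const_mul Ch).add
      ((hasDerivAt_id S₀).const_mul Cv)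
    exact h.congr_deriv (by ring)
  have hf : HasDerivAt (fun s => ρ₀ / a s - pc s)
      (-((Cv - Ch) * ρ₀ + a S₀ ^ 2 * q) / a S₀ ^ 2) S₀ := by
    have h := ((hasDerivAt_const S₀ ρ₀).div ha_deriv ha_pos.ne').sub hpcq
    refine h.congr_deriv ?_
    have := ha_pos.ne'
    field_simp
    ring
  have ha_ne : ∀ᶠ p in nhds p₀, a (S p) ≠ 0 := by
    have hc : ContinuousAt (fun p => a (S p)) p₀ :=
      ContinuousAt.comp (g := a) (by rw [hSval]; exact ha_deriv.continuousAt) hScont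
    exact hc.eventually_ne (by simpa only [hSval] using ha_pos.ne')
  have hinv : ∀ᶠ p in nhds p₀, ρ₀ / a (S p) - pc (S p) = p := by
    filter_upwards [hSimp, ha_ne] with p hp hne
    rw [← hp, mul_div_cancel_left₀ _ hne, add_sub_cancel_right]
  have hS := HasDerivAt.of_local_left_inverse hScont (by rw [hSval]; exact hf)
    (div_ne_zero (neg_ne_zero.2 hden.ne') (pow_pos ha_pos 2).ne') hinv
  refine ⟨hS.congr_deriv ?_, div_neg_of_neg_of_pos (neg_neg_of_pos (pow_pos ha_pos 2)) hden⟩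
  rw [inv_div, div_neg, neg_div]
end

section
/- Fix p ∈ ℝ with p + p_c(0) ≥ 0, and set ρ* := C_h·(p + p_c(0)). Assume p_c is continuously differentiable on (0,1) with p_c'(S) > 0 and p_c'(S) → +∞ as S → 0⁺. Let 𝒮(ρ) denote, for ρ > ρ* (and ρ ≤ C_v·(p + p_c(1))), the unique S ∈ (0,1] with ρ = a(S)·(p + p_c(S)), and define N(ρ) := C_Δ·ρ / (C_Δ·ρ + a(𝒮(ρ))²·p_c'(𝒮(ρ))). Then N(ρ) → 0 as ρ → ρ*⁺; i.e., the auxiliary coefficient N extends continuously by the value 0 across the phase-appearance threshold. -/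
open Set Filter

/-- continuity across the phase-appearance threshold of the
auxiliary coefficient `N(ρ) = C_Δ ρ/(C_Δ ρ + a(𝒮(ρ))² p_c'(𝒮(ρ)))` of the
total-concentration formulation: if `p_c' > 0` on `(0,1)` and `p_c'(S) → +∞` as
`S → 0⁺`, then `N(ρ) → 0` as `ρ → ρ*⁺`, where `ρ* = C_h(p + p_c(0))` and, for
`ρ* < ρ ≤ C_v(p + p_c(1))`, `𝒮(ρ)` is the unique `S ∈ (0,1]` with
`ρ = a(S)(p + p_c(S))`. -/
theorem stmt_13
    (Ch Cv : ℝ) (hCh : 0 < Ch) (hCC : Ch < Cv)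
    (pc pc' : ℝ → ℝ)
    (hpc_cont : ContinuousOn pc (Icc 0 1))
    (hpc_mono : StrictMonoOn pc (Icc 0 1))
    (hpc_deriv : ∀ s ∈ Ioo (0:ℝ) 1, HasDerivAt pc (pc' s) s)
    (hpc'_cont : ContinuousOn pc' (Ioo 0 1))
    (hpc'_pos : ∀ s ∈ Ioo (0:ℝ) 1, 0 < pc' s)
    (hpc'_top : Tendsto pc' (nhdsWithin 0 (Ioi 0)) atTop)
    (p : ℝ) (hp : 0 ≤ p + pc 0)
    (S : ℝ → ℝ)
    (hS : ∀ ρ : ℝ, Ch * (p + pc 0) < ρ → ρ ≤ Cv * (p + pc 1) →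
      S ρ ∈ Ioc (0:ℝ) 1 ∧ ρ = (Ch * (1 - S ρ) + Cv * S ρ) * (p + pc (S ρ))) :
    Tendsto
      (fun ρ : ℝ => (Cv - Ch) * ρ /
        ((Cv - Ch) * ρ + (Ch * (1 - S ρ) + Cv * S ρ) ^ 2 * pc' (S ρ)))
      (nhdsWithin (Ch * (p + pc 0)) (Ioi (Ch * (p + pc 0)))) (nhds 0) := by
  have hend : Ch * (p + pc 0) < Cv * (p + pc 1) := by
    have h01 : pc 0 < pc 1 := hpc_mono (by simp) (by simp) one_pos
    nlinarith
  have hgt : ∀ᶠ ρ in nhdsWithin (Ch * (p + pc 0)) (Ioi (Ch * (p + pc 0))),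
      S ρ ∈ Ioc (0:ℝ) 1 ∧ ρ = (Ch * (1 - S ρ) + Cv * S ρ) * (p + pc (S ρ)) := by
    filter_upwards [Ioc_mem_nhdsGT hend] with ρ hρ using hS ρ hρ.1 hρ.2
  have hS0 : Tendsto S (nhdsWithin (Ch * (p + pc 0)) (Ioi (Ch * (p + pc 0))))
      (nhdsWithin 0 (Ioi 0)) := by
    refine tendsto_nhdsWithin_iff.2 ⟨?_, hgt.mono fun ρ h => h.1.1⟩
    refine tendsto_order.2 ⟨fun b hb => hgt.mono fun ρ h => hb.trans h.1.1, fun b hb => ?_⟩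
    obtain ⟨ε, hε0, hε⟩ := exists_between (lt_min hb one_pos)
    have hεb : ε < b := hε.trans_le (min_le_left _ _)
    have hε1 : ε < 1 := hε.trans_le (min_le_right _ _)
    have hpcε : pc 0 < pc ε := hpc_mono (by simp) ⟨hε0.le, hε1.le⟩ hε0
    have haε : 0 < (Cv - Ch) * ε := mul_pos (sub_pos.2 hCC) hε0
    have hthr : Ch * (p + pc 0) < (Ch * (1 - ε) + Cv * ε) * (p + pc ε) := by
      nlinarith
    filter_upwards [hgt, Ioo_mem_nhdsGT hthr] with ρ h hρ
    by_contra! hbS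
    have hεS : ε ≤ S ρ := hεb.le.trans hbS
    have hpcS : pc ε ≤ pc (S ρ) :=
      hpc_mono.monotoneOn ⟨hε0.le, hε1.le⟩ ⟨h.1.1.le, h.1.2⟩ hεS
    have haS : (Cv - Ch) * ε ≤ (Cv - Ch) * S ρ :=
      mul_le_mul_of_nonneg_left hεS (sub_pos.2 hCC).le
    have hle : (Ch * (1 - ε) + Cv * ε) * (p + pc ε) ≤
        (Ch * (1 - S ρ) + Cv * S ρ) * (p + pc (S ρ)) :=
      mul_le_mul (by linarith) (by linarith) (by linarith) (by linarith)
    linarith [hρ.2, h.2]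
  have hnum : Tendsto (fun ρ : ℝ => (Cv - Ch) * ρ)
      (nhdsWithin (Ch * (p + pc 0)) (Ioi (Ch * (p + pc 0))))
      (nhds ((Cv - Ch) * (Ch * (p + pc 0)))) :=
    (tendsto_id.mono_left nhdsWithin_le_nhds).const_mul _
  have ha : Tendsto (fun ρ : ℝ => (Ch * (1 - S ρ) + Cv * S ρ) ^ 2)
      (nhdsWithin (Ch * (p + pc 0)) (Ioi (Ch * (p + pc 0)))) (nhds (Ch ^ 2)) := by
    have h0 := tendsto_nhds_of_tendsto_nhdsWithin hS0
    simpa using (((h0.const_sub 1).const_mul Ch).add (h0.const_mul Cv)).pow 2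
  exact hnum.div_atTop (hnum.add_atTop (ha.pos_mul_atTop (by positivity) (hpc'_top.comp hS0)))
end

section
/- Fix p ∈ ℝ with p + p_c(0) ≥ 0, and set ρ* := C_h·(p + p_c(0)). Assume p_c is continuously differentiable on (0,1) with p_c'(S) > 0 and p_c'(S) → +∞ as S → 0⁺. Let 𝒮(ρ) denote, for ρ > ρ* (and ρ ≤ C_v·(p + p_c(1))), the unique S ∈ (0,1] with ρ = a(S)·(p + p_c(S)). Then the derivative coefficient ∂S_g/∂ρ_tot^h, namely a(𝒮(ρ)) / (C_Δ·ρ + a(𝒮(ρ))²·p_c'(𝒮(ρ))), tends to 0 as ρ → ρ*⁺; i.e., it extends continuously by the value 0 (its one-phase value) across the phase-appearance threshold. -/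
open Set Filter

/-- continuity across the phase-appearance threshold of the
derivative coefficient `∂S_g/∂ρ_tot^h = a(𝒮(ρ))/(C_Δ ρ + a(𝒮(ρ))² p_c'(𝒮(ρ)))`:
if `p_c' > 0` on `(0,1)` and `p_c'(S) → +∞` as `S → 0⁺`, then this coefficient
tends to `0` (its one-phase value) as `ρ → ρ*⁺`, where `ρ* = C_h(p + p_c(0))`
and, for `ρ* < ρ ≤ C_v(p + p_c(1))`, `𝒮(ρ)` is the unique `S ∈ (0,1]` with
`ρ = a(S)(p + p_c(S))`. -/
theorem stmt_14
    (Ch Cv : ℝ) (hCh : 0 < Ch) (hCC : Ch < Cv)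
    (pc pc' : ℝ → ℝ)
    (hpc_cont : ContinuousOn pc (Icc 0 1))
    (hpc_mono : StrictMonoOn pc (Icc 0 1))
    (hpc_deriv : ∀ s ∈ Ioo (0:ℝ) 1, HasDerivAt pc (pc' s) s)
    (hpc'_cont : ContinuousOn pc' (Ioo 0 1))
    (hpc'_pos : ∀ s ∈ Ioo (0:ℝ) 1, 0 < pc' s)
    (hpc'_top : Tendsto pc' (nhdsWithin 0 (Ioi 0)) atTop)
    (p : ℝ) (hp : 0 ≤ p + pc 0)
    (S : ℝ → ℝ)
    (hS : ∀ ρ : ℝ, Ch * (p + pc 0) < ρ → ρ ≤ Cv * (p + pc 1) →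
      S ρ ∈ Ioc (0:ℝ) 1 ∧ ρ = (Ch * (1 - S ρ) + Cv * S ρ) * (p + pc (S ρ))) :
    Tendsto
      (fun ρ : ℝ => (Ch * (1 - S ρ) + Cv * S ρ) /
        ((Cv - Ch) * ρ + (Ch * (1 - S ρ) + Cv * S ρ) ^ 2 * pc' (S ρ)))
      (nhdsWithin (Ch * (p + pc 0)) (Ioi (Ch * (p + pc 0)))) (nhds 0) := by
  have mono : ∀ ε ∈ Ioc (0:ℝ) 1, pc 0 < pc ε := fun ε hε =>
    hpc_mono ⟨le_rfl, zero_le_one⟩ ⟨hε.1.le, hε.2⟩ hε.1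
  have hρ_gt : ∀ᶠ ρ in nhdsWithin (Ch * (p + pc 0)) (Ioi (Ch * (p + pc 0))),
      Ch * (p + pc 0) < ρ := self_mem_nhdsWithin
  have hρ_lt : ∀ b, Ch * (p + pc 0) < b →
      ∀ᶠ ρ in nhdsWithin (Ch * (p + pc 0)) (Ioi (Ch * (p + pc 0))), ρ < b := fun b hb =>
    nhdsWithin_le_nhds (Iio_mem_nhds hb)
  have hρ_max : Ch * (p + pc 0) < Cv * (p + pc 1) := by
    nlinarith [mono 1 ⟨one_pos, le_rfl⟩]
  have hS_tendsto : Tendsto S (nhdsWithin (Ch * (p + pc 0)) (Ioi (Ch * (p + pc 0))))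
      (nhdsWithin 0 (Ioi 0)) := by
    refine (nhdsGT_basis_of_exists_gt ⟨(1:ℝ), one_pos⟩).tendsto_right_iff.2 fun ε hε => ?_
    have hδ : min ε 1 ∈ Ioc (0:ℝ) 1 := ⟨lt_min hε one_pos, min_le_right _ _⟩
    have hδ_lt : Ch * (p + pc 0) < Ch * (p + pc (min ε 1)) := by
      have := mono _ hδ
      gcongr
    filter_upwards [hρ_gt, hρ_lt _ hρ_max, hρ_lt _ hδ_lt] with ρ h₁ h₂ h₃
    obtain ⟨hSρ, hEq⟩ := hS ρ h₁ h₂.le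
    refine ⟨hSρ.1, lt_of_not_ge fun hge => ?_⟩
    have hle : pc (min ε 1) ≤ pc (S ρ) :=
      hpc_mono.monotoneOn ⟨hδ.1.le, hδ.2⟩ ⟨hSρ.1.le, hSρ.2⟩ ((min_le_left _ _).trans hge)
    have hpos : 0 ≤ p + pc (S ρ) := by linarith [mono _ hSρ]
    have hCa : 0 ≤ (Cv - Ch) * S ρ * (p + pc (S ρ)) :=
      mul_nonneg (mul_nonneg (by linarith) hSρ.1.le) hpos
    nlinarith
  have hpc'_S := hpc'_top.comp hS_tendsto
  refine squeeze_zero' (g := fun ρ => (Ch * pc' (S ρ))⁻¹) ?_ ?_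
    (hpc'_S.const_mul_atTop hCh).inv_tendsto_atTop
  all_goals
    filter_upwards [hρ_gt, hρ_lt _ hρ_max, hpc'_S.eventually_gt_atTop 0] with ρ h₁ h₂ h₃
    have hSρ := (hS ρ h₁ h₂.le).1
    have hd : 0 < pc' (S ρ) := h₃
    have hρ : 0 ≤ (Cv - Ch) * ρ :=
      mul_nonneg (by linarith) ((mul_nonneg hCh.le hp).trans h₁.le)
    have ha : Ch ≤ Ch * (1 - S ρ) + Cv * S ρ := by nlinarith [hSρ.1]
    generalize Ch * (1 - S ρ) + Cv * S ρ = a at ha ⊢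
    have ha₀ : 0 < a := hCh.trans_le ha
  · positivity
  · rw [div_le_iff₀ (by positivity), inv_mul_eq_div, le_div_iff₀ (by positivity)]
    have : a * pc' (S ρ) * Ch ≤ a * pc' (S ρ) * a := by gcongr
    nlinarith
end
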